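/- Let A be a commutative ring equipped with a ring involution * in which 2 is invertible, and let i, j be ideals of A with i ⊆ j, a* ∈ j for every a ∈ j, j² ⊆ i, and i·j = (0). Let V be a free A-module with basis {t, v}, and let h be a hermitian sesquilinear form on V with h(t,v) = 0 and with h(t,t) = e and h(v,v) = d both units of A. Then for every a ∈ j there exists an A-linear automorphism g of V such that h(g(x), g(y)) = h(x,y) for all x, y ∈ V, g(x) − x ∈ jV for all x ∈ V, and g(t) − t − a•v ∈ iV. -/

import Mathlib

/-- The linear automorphism of a rank-two free module with matrix `!![c, -w; a, c]` of
determinant one. -/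
noncomputable def rotationEquiv {A V : Type*} [CommRing A] [AddCommGroup V] [Module A V]
    (b : Module.Basis (Fin 2) A V) (c a w : A) (hdet : c * c + a * w = 1) : V ≃ₗ[A] V :=
  LinearEquiv.ofLinearMap
    (b.constr A ![c • b 0 + a • b 1, (-w) • b 0 + c • b 1])
    (b.constr A ![c • b 0 + (-a) • b 1, w • b 0 + c • b 1])
    (b.ext fun k => by
      fin_cases k
      · simp only [Fin.zero_eta, LinearMap.comp_apply, Module.Basis.constr_basis, map_add, map_smul,
          Matrix.cons_val_zero, Matrix.cons_val_one, LinearMap.id_apply]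
        linear_combination (norm := module) hdet • b 0
      · simp only [Fin.mk_one, LinearMap.comp_apply, Module.Basis.constr_basis, map_add, map_smul,
          Matrix.cons_val_zero, Matrix.cons_val_one, LinearMap.id_apply]
        linear_combination (norm := module) hdet • b 1)
    (b.ext fun k => by
      fin_cases k
      · simp only [Fin.zero_eta, LinearMap.comp_apply, Module.Basis.constr_basis, map_add, map_smul,
          Matrix.cons_val_zero, Matrix.cons_val_one, LinearMap.id_apply]
        linear_combination (norm := module) hdet • b 0
      · simp only [Fin.mk_one, LinearMap.comp_apply, Module.Basis.constr_basis, map_add, map_smul,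
          Matrix.cons_val_zero, Matrix.cons_val_one, LinearMap.id_apply]
        linear_combination (norm := module) hdet • b 1)

theorem rotationEquiv_basis_zero {A V : Type*} [CommRing A] [AddCommGroup V] [Module A V]
    (b : Module.Basis (Fin 2) A V) (c a w : A) (hdet : c * c + a * w = 1) :
    rotationEquiv b c a w hdet (b 0) = c • b 0 + a • b 1 := by
  simp [rotationEquiv]

theorem rotationEquiv_basis_one {A V : Type*} [CommRing A] [AddCommGroup V] [Module A V]
    (b : Module.Basis (Fin 2) A V) (c a w : A) (hdet : c * c + a * w = 1) :
    rotationEquiv b c a w hdet (b 1) = (-w) • b 0 + c • b 1 := by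
  simp [rotationEquiv]

/-- A ring endomorphism fixing `x` fixes every inverse of `x`. -/
theorem map_eq_self_of_mul_eq_one {A : Type*} [CommRing A] (σ : A →+* A) {x y : A}
    (hx : σ x = x) (hxy : x * y = 1) : σ y = y := by
  have hmap : x * σ y = 1 := by rw [← hx, ← map_mul, hxy, map_one]
  linear_combination y * hmap - σ y * hxy

/-- Non-isotropic rank-2 case: with `i ⊆ j`, `j` `*`-invariant, `j² ⊆ i`,
`i·j = (0)` and 2 invertible, if `V` is free with orthogonal basis `{t, v}`
for a hermitian form `h` with `h(t,t)` and `h(v,v)` units, then for every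
`a ∈ j` there is an `A`-linear automorphism `g` of `V` preserving `h`, lying
in `Ω(j)`, with `g(t) - t - a•v ∈ iV`. -/
theorem stmt_16 {A V : Type*} [CommRing A] [AddCommGroup V] [Module A V]
    (σ : A →+* A) (hσ : ∀ a : A, σ (σ a) = a)
    (h2 : IsUnit (2 : A))
    (i j : Ideal A) (hij : i ≤ j) (hjstar : ∀ a ∈ j, σ a ∈ j)
    (hji : j * j ≤ i) (hijz : i * j = ⊥)
    (b : Module.Basis (Fin 2) A V) (t v : V) (hbt : b 0 = t) (hbv : b 1 = v)
    (h : V → V → A)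
    (hadd₁ : ∀ x x' y : V, h (x + x') y = h x y + h x' y)
    (hadd₂ : ∀ x y y' : V, h x (y + y') = h x y + h x y')
    (hsmul₁ : ∀ (a : A) (x y : V), h (a • x) y = σ a * h x y)
    (hsmul₂ : ∀ (a : A) (x y : V), h x (a • y) = a * h x y)
    (hherm : ∀ x y : V, h y x = σ (h x y))
    (htv : h t v = 0) (he : IsUnit (h t t)) (hd : IsUnit (h v v)) :
    ∀ a ∈ j, ∃ g : V ≃ₗ[A] V,
      (∀ x y : V, h (g x) (g y) = h x y) ∧
      (∀ x : V, g x - x ∈ j • (⊤ : Submodule A V)) ∧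
      g t - t - a • v ∈ i • (⊤ : Submodule A V) := by
  subst hbt hbv
  intro a ha
  obtain ⟨einv, hinv⟩ := he.exists_right_inv
  obtain ⟨r, hr⟩ := h2.exists_right_inv
  have hvt : h (b 1) (b 0) = 0 := by rw [hherm, htv, map_zero]
  have hσinv : σ einv = einv := map_eq_self_of_mul_eq_one σ (hherm _ _).symm hinv
  have hσr : σ r = r := map_eq_self_of_mul_eq_one σ (map_ofNat σ 2) hr
  have hσd : σ (h (b 1) (b 1)) = h (b 1) (b 1) := (hherm _ _).symm
  obtain ⟨e, hedef⟩ : ∃ e, h (b 0) (b 0) = e := ⟨_, rfl⟩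
  obtain ⟨d, hddef⟩ : ∃ d, h (b 1) (b 1) = d := ⟨_, rfl⟩
  rw [hedef] at hinv
  rw [hddef] at hσd
  have haa : a * σ a ∈ i := hji (Ideal.mul_mem_mul ha (hjstar a ha))
  have hsq : (a * σ a) * (a * σ a) = 0 := by
    rw [← Ideal.mem_bot, ← hijz]
    exact Ideal.mul_mem_mul haa (hij haa)
  obtain ⟨w, hw⟩ : ∃ w, w = σ a * d * einv := ⟨_, rfl⟩
  obtain ⟨c, hc⟩ : ∃ c, c = 1 - r * (a * w) := ⟨_, rfl⟩
  have hwj : w ∈ j := by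
    rw [hw, mul_assoc]
    exact j.mul_mem_right _ (hjstar a ha)
  have hci : c - 1 ∈ i := by
    have : c - 1 = (-(r * d * einv)) * (a * σ a) := by rw [hc, hw]; ring
    rw [this]
    exact i.mul_mem_left _ haa
  have hσw : σ w = a * d * einv := by rw [hw, map_mul, map_mul, hσ, hσd, hσinv]
  have hσc : σ c = c := by
    rw [hc, map_sub, map_one, map_mul, map_mul, hσr, hσw, hw]
    ring
  have hdet : c * c + a * w = 1 := by
    rw [hc, hw]
    linear_combination (-(a * σ a * d * einv)) * hr + (r * d * einv) ^ 2 * hsq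
  have hwe : w * e = σ a * d := by rw [hw]; linear_combination σ a * d * hinv
  have hσwe : σ w * e = a * d := by rw [hσw]; linear_combination a * d * hinv
  have hg0 := rotationEquiv_basis_zero b c a w hdet
  have hg1 := rotationEquiv_basis_one b c a w hdet
  have hexp : ∀ x : V, x = b.repr x 0 • b 0 + b.repr x 1 • b 1 := fun x => by
    rw [← Fin.sum_univ_two (fun k => b.repr x k • b k), b.sum_repr]
  refine ⟨rotationEquiv b c a w hdet, fun x y => ?_, fun x => ?_, ?_⟩
  · rw [hexp x, hexp y]
    generalize b.repr x 0 = x₀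
    generalize b.repr x 1 = x₁
    generalize b.repr y 0 = y₀
    generalize b.repr y 1 = y₁
    simp only [map_add, map_smul, hg0, hg1, hadd₁, hadd₂, hsmul₁, hsmul₂, htv, hvt, hedef, hddef,
      map_neg, hσc]
    linear_combination (σ x₀ * y₀ * e + σ x₁ * y₁ * d) * hdet
      - (σ x₀ * y₀ * a + σ x₀ * y₁ * c) * hwe + (σ x₁ * y₁ * w - σ x₁ * y₀ * c) * hσwe
  · have hsplit : rotationEquiv b c a w hdet x - x =
        (b.repr x 0 * (c - 1) - b.repr x 1 * w) • b 0 +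
          (b.repr x 0 * a + b.repr x 1 * (c - 1)) • b 1 := by
      conv_lhs => rw [hexp x]
      simp only [map_add, map_smul, hg0, hg1]
      module
    rw [hsplit]
    exact add_mem
      (Submodule.smul_mem_smul
        (sub_mem (j.mul_mem_left _ (hij hci)) (j.mul_mem_left _ hwj)) trivial)
      (Submodule.smul_mem_smul
        (add_mem (j.mul_mem_left _ ha) (j.mul_mem_left _ (hij hci))) trivial)
  · have hsplit : rotationEquiv b c a w hdet (b 0) - b 0 - a • b 1 = (c - 1) • b 0 := by
      rw [hg0]
      module
    rw [hsplit]
    exact Submodule.smul_mem_smul hci trivial
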